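/- Let $n_1, \dots, n_k \ge 1$, let $X_i$ be an $n_i$-dimensional real normed space with $d_i = d_{BM}(X_i, \ell_2^{n_i})$, and define $f(p) = d_{BM}(X_1 \oplus_p \cdots \oplus_p X_k, \ell_2^{n_1+\dots+n_k})$ for $p \in [1,\infty]$. Then $\max\{d_1,\dots,d_k\} = f(2) \le f(p) = f(p/(p-1)) \le f(1) = f(\infty) = \sqrt{d_1^2 + \dots + d_k^2}$. -/

import Mathlib

open scoped ENNReal

/-- The (multiplicative) Banach–Mazur distance between two normed spaces:
the infimum of `‖T‖ * ‖T⁻¹‖` over invertible (continuous) linear maps `T : E → F`. -/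
noncomputable def dBM (E F : Type*) [NormedAddCommGroup E] [NormedSpace ℝ E]
    [NormedAddCommGroup F] [NormedSpace ℝ F] : ℝ :=
  sInf {c : ℝ | ∃ T : E ≃L[ℝ] F, c = ‖(T : E →L[ℝ] F)‖ * ‖(T.symm : F →L[ℝ] E)‖}

/-- The `ℓ_p` norm on real tuples. -/
noncomputable def nrm {k : ℕ} (p : ℝ≥0∞) [Fact (1 ≤ p)] (t : Fin k → ℝ) : ℝ :=
  ‖(WithLp.toLp p t : PiLp p (fun _ : Fin k => ℝ))‖

theorem nrm_nonneg {k : ℕ} (p : ℝ≥0∞) [Fact (1 ≤ p)] (t : Fin k → ℝ) : 0 ≤ nrm p t :=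
  norm_nonneg _

theorem toReal_pos_of_fact {p : ℝ≥0∞} [h : Fact (1 ≤ p)] (hp : p ≠ ∞) : 0 < p.toReal :=
  ENNReal.toReal_pos (zero_lt_one.trans_le h.out).ne' hp

theorem nrm_eq_sum {k : ℕ} {p : ℝ≥0∞} [Fact (1 ≤ p)] (hp : p ≠ ∞) (t : Fin k → ℝ) :
    nrm p t = (∑ i, |t i| ^ p.toReal) ^ (1 / p.toReal) := by
  unfold nrm
  rw [PiLp.norm_eq_sum (toReal_pos_of_fact hp)]
  simp [Real.norm_eq_abs]

theorem nrm_top {k : ℕ} (t : Fin k → ℝ) : nrm ∞ t = ⨆ i, |t i| := by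
  unfold nrm
  rw [PiLp.norm_eq_ciSup]
  simp [Real.norm_eq_abs]

theorem nrm_two_sq {k : ℕ} (t : Fin k → ℝ) : nrm 2 t ^ 2 = ∑ i, t i ^ 2 := by
  unfold nrm
  rw [PiLp.norm_sq_eq_of_L2]
  simp

theorem norm_eq_nrm {k : ℕ} (p : ℝ≥0∞) [Fact (1 ≤ p)] (X : Fin k → Type)
    [∀ i, NormedAddCommGroup (X i)] (x : PiLp p X) : ‖x‖ = nrm p (fun i => ‖x i‖) := by
  by_cases hp : p = ∞
  · subst hp
    rw [nrm_top, PiLp.norm_eq_ciSup]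
    simp
  · rw [nrm_eq_sum hp, PiLp.norm_eq_sum (toReal_pos_of_fact hp)]
    simp

theorem nrm_mono {k : ℕ} (p : ℝ≥0∞) [Fact (1 ≤ p)] {s t : Fin k → ℝ}
    (h : ∀ i, |s i| ≤ |t i|) : nrm p s ≤ nrm p t := by
  by_cases hp : p = ∞
  · subst hp
    rw [nrm_top, nrm_top]
    exact ciSup_mono (Set.finite_range _).bddAbove h
  · rw [nrm_eq_sum hp, nrm_eq_sum hp]
    have := toReal_pos_of_fact hp
    apply Real.rpow_le_rpow (Finset.sum_nonneg fun i _ => by positivity) _ (by positivity)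
    exact Finset.sum_le_sum fun i _ => Real.rpow_le_rpow (abs_nonneg _) (h i) this.le

theorem nrm_congr {k : ℕ} (p : ℝ≥0∞) [Fact (1 ≤ p)] {s t : Fin k → ℝ}
    (h : ∀ i, |s i| = |t i|) : nrm p s = nrm p t :=
  le_antisymm (nrm_mono p fun i => (h i).le) (nrm_mono p fun i => (h i).ge)

theorem nrm_smul {k : ℕ} (p : ℝ≥0∞) [Fact (1 ≤ p)] (c : ℝ) (hc : 0 ≤ c) (t : Fin k → ℝ) :
    nrm p (fun i => c * t i) = c * nrm p t := by
  have : (WithLp.toLp p (fun i => c * t i) : PiLp p (fun _ : Fin k => ℝ))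
      = c • WithLp.toLp p t := by ext i; simp
  unfold nrm
  rw [this, norm_smul, Real.norm_eq_abs, abs_of_nonneg hc]

theorem abs_le_nrm {k : ℕ} (p : ℝ≥0∞) [Fact (1 ≤ p)] (t : Fin k → ℝ) (i : Fin k) :
    |t i| ≤ nrm p t := by
  have := PiLp.norm_apply_le (p := p) (WithLp.toLp p t : PiLp p (fun _ : Fin k => ℝ)) i
  simpa [nrm] using this

theorem nrm_single {k : ℕ} (p : ℝ≥0∞) [Fact (1 ≤ p)] (i : Fin k) (c : ℝ) :
    nrm p (Pi.single i c) = |c| := by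
  unfold nrm
  exact PiLp.norm_single p (fun _ : Fin k => ℝ) i c

theorem nrm_eq_zero {k : ℕ} (p : ℝ≥0∞) [Fact (1 ≤ p)] {t : Fin k → ℝ} (h : nrm p t = 0) :
    t = 0 := by
  funext i
  have := abs_le_nrm p t i
  rw [h] at this
  exact abs_nonpos_iff.mp this

theorem nrm_zero {k : ℕ} (p : ℝ≥0∞) [Fact (1 ≤ p)] : nrm p (0 : Fin k → ℝ) = 0 := by
  unfold nrm; simp

theorem nrm_anti {k : ℕ} (p q : ℝ≥0∞) [hp1 : Fact (1 ≤ p)] [Fact (1 ≤ q)] (hpq : p ≤ q)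
    (t : Fin k → ℝ) : nrm q t ≤ nrm p t := by
  by_cases hq : q = ∞
  · subst hq
    rw [nrm_top]
    exact Real.iSup_le (fun i => abs_le_nrm p t i) (nrm_nonneg _ _)
  have hp : p ≠ ∞ := ne_top_of_le_ne_top hq hpq
  have hp0 := toReal_pos_of_fact hp
  have hq0 := toReal_pos_of_fact hq
  rcases (nrm_nonneg p t).eq_or_lt with h0 | h0
  · rw [nrm_eq_zero p h0.symm, nrm_zero, nrm_zero]
  set c := nrm p t with hc
  have key : nrm q (fun i => c⁻¹ * t i) ≤ 1 := by
    have h1 : nrm p (fun i => c⁻¹ * t i) = 1 := by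
      rw [nrm_smul _ _ (by positivity), ← hc, inv_mul_cancel₀ h0.ne']
    have h2 : ∑ i, |c⁻¹ * t i| ^ p.toReal = 1 := by
      rw [nrm_eq_sum hp] at h1
      exact (Real.rpow_left_inj (Finset.sum_nonneg fun i _ => by positivity) zero_le_one
        (one_div_pos.mpr hp0).ne').mp (by rw [h1, Real.one_rpow])
    rw [nrm_eq_sum hq]
    apply Real.rpow_le_one (Finset.sum_nonneg fun i _ => by positivity) _ (by positivity)
    rw [← h2]
    apply Finset.sum_le_sum
    intro i _
    have h3 : |c⁻¹ * t i| ≤ 1 := by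
      have := abs_le_nrm p (fun i => c⁻¹ * t i) i
      rwa [h1] at this
    exact Real.rpow_le_rpow_of_exponent_ge_of_imp (abs_nonneg _) h3
      (ENNReal.toReal_mono hq hpq) (fun _ h => absurd h hq0.ne')
  rw [nrm_smul _ _ (by positivity), inv_mul_le_iff₀ h0] at key
  simpa using key

theorem holder_nrm {k : ℕ} (p q : ℝ≥0∞) [Fact (1 ≤ p)] [Fact (1 ≤ q)]
    (hpq : 1 / p + 1 / q = 1) (hq : q ≠ ∞) (s t : Fin k → ℝ) :
    ∑ i, s i * t i ≤ nrm p s * nrm q t := by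
  by_cases hp : p = ∞
  · subst hp
    have hq1 : q = 1 := by simpa using hpq
    subst hq1
    rw [nrm_eq_sum hq t, Finset.sum_congr rfl (fun i _ => rfl)]
    simp only [ENNReal.toReal_one, Real.rpow_one, div_one]
    rw [Finset.mul_sum]
    apply Finset.sum_le_sum
    intro i _
    calc s i * t i ≤ |s i| * |t i| := by rw [← abs_mul]; exact le_abs_self _
      _ ≤ _ := by gcongr; exact abs_le_nrm _ _ _
  · by_cases hq1 : q = 1
    · subst hq1
      exfalso
      apply hp
      have h : p⁻¹ + 1 = 0 + 1 := by simpa using hpq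
      have := (ENNReal.add_left_inj (by simp)).mp h
      simpa using this
    have hconj : p.HolderConjugate q := by
      rw [ENNReal.holderConjugate_iff]; simpa using hpq
    rw [nrm_eq_sum hp, nrm_eq_sum hq]
    exact Real.inner_le_Lp_mul_Lq _ _ _ (ENNReal.HolderConjugate.toReal_of_ne_top hp hq)

theorem attain_nrm {k : ℕ} (p q : ℝ≥0∞) [Fact (1 ≤ p)] [Fact (1 ≤ q)]
    (hpq : 1 / p + 1 / q = 1) (hq : q ≠ ∞) (y : Fin k → ℝ) (hy : y ≠ 0) :
    ∃ z : Fin k → ℝ, nrm q y * nrm p z ≤ ∑ i, y i * z i ∧ 0 < nrm p z := by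
  have hq0 := toReal_pos_of_fact hq
  have hy' : 0 < nrm q y :=
    lt_of_le_of_ne (nrm_nonneg _ _) fun h => hy (nrm_eq_zero q h.symm)
  have hS0 : 0 ≤ ∑ i, |y i| ^ q.toReal := Finset.sum_nonneg fun i _ => by positivity
  have hS : 0 < ∑ i, |y i| ^ q.toReal := by
    rw [nrm_eq_sum hq] at hy'
    refine lt_of_le_of_ne hS0 fun h => ?_
    rw [← h, Real.zero_rpow (one_div_pos.mpr hq0).ne'] at hy'
    exact lt_irrefl _ hy'
  by_cases hp : p = ∞
  · subst hp
    have hq1 : q = 1 := by simpa using hpq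
    subst hq1
    refine ⟨fun i => SignType.sign (y i), ?_, ?_⟩
    · have h1 : nrm ∞ (fun i => ((SignType.sign (y i) : SignType) : ℝ)) ≤ 1 := by
        rw [nrm_top]
        refine Real.iSup_le (fun i => ?_) zero_le_one
        rcases lt_trichotomy (y i) 0 with h | h | h <;> simp [h]
      have h2 : ∑ i, y i * ((SignType.sign (y i) : SignType) : ℝ) = nrm 1 y := by
        rw [nrm_eq_sum hq]
        simp [mul_comm (y _), sign_mul_self]
      rw [h2]
      exact mul_le_of_le_one_right hy'.le h1
    · refine lt_of_le_of_ne (nrm_nonneg _ _) fun h => hy ?_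
      have := nrm_eq_zero _ h.symm
      funext i
      have := congrFun this i
      rcases lt_trichotomy (y i) 0 with h | h | h
      · simp [h] at this
      · exact h
      · simp [h] at this
  · have hconj : p.HolderConjugate q := by
      rw [ENNReal.holderConjugate_iff]; simpa using hpq
    have hc : p.toReal.HolderConjugate q.toReal :=
      ENNReal.HolderConjugate.toReal_of_ne_top hp hq
    have hq1 : 1 < q.toReal := hc.symm.lt
    have hp0 : 0 < p.toReal := hc.pos
    have hz : nrm p (fun i => SignType.sign (y i) * |y i| ^ (q.toReal - 1))
        = (∑ i, |y i| ^ q.toReal) ^ (1 / p.toReal) := by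
      rw [nrm_eq_sum hp]
      congr 1
      refine Finset.sum_congr rfl fun i _ => ?_
      by_cases h0 : y i = 0
      · simp [h0, Real.zero_rpow hq0.ne', Real.zero_rpow hp0.ne']
      · have : |((SignType.sign (y i) : SignType) : ℝ) * |y i| ^ (q.toReal - 1)|
            = |y i| ^ (q.toReal - 1) := by
          rw [abs_mul, abs_of_nonneg (a := |y i| ^ (q.toReal - 1)) (by positivity)]
          rcases lt_or_gt_of_ne h0 with h | h <;> simp [h]
        rw [this, ← Real.rpow_mul (abs_nonneg _), hc.symm.sub_one_mul_conj]
    refine ⟨fun i => SignType.sign (y i) * |y i| ^ (q.toReal - 1), ?_, ?_⟩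
    · rw [hz, nrm_eq_sum hq, ← Real.rpow_add hS]
      have h1 : 1 / q.toReal + 1 / p.toReal = 1 := by
        simpa using hc.symm.inv_add_inv_eq_one
      rw [h1, Real.rpow_one]
      refine (Finset.sum_congr rfl fun i _ => ?_).le
      rw [← mul_assoc, mul_comm (y i), sign_mul_self]
      by_cases h0 : y i = 0
      · simp [h0, Real.zero_rpow hq0.ne']
      · have := abs_pos.mpr h0
        rw [Real.rpow_sub_one this.ne']
        field_simp
    · rw [hz]; positivity

theorem dual_nrm {k : ℕ} (p p' r r' : ℝ≥0∞) [Fact (1 ≤ p)] [Fact (1 ≤ p')] [Fact (1 ≤ r)]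
    [Fact (1 ≤ r')] (hp : 1 / p + 1 / p' = 1) (hp' : p' ≠ ∞) (hr : 1 / r' + 1 / r = 1)
    (hr' : r ≠ ∞) (d : Fin k → ℝ) (C : ℝ) (hC : 0 ≤ C)
    (h : ∀ t : Fin k → ℝ, nrm r (fun i => d i * t i) ≤ C * nrm p t) (t : Fin k → ℝ) :
    nrm p' (fun i => d i * t i) ≤ C * nrm r' t := by
  by_cases h0 : (fun i => d i * t i) = 0
  · rw [h0, nrm_zero]
    exact mul_nonneg hC (nrm_nonneg _ _)
  obtain ⟨z, hz, hz0⟩ := attain_nrm p p' hp hp' _ h0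
  have h1 := holder_nrm r' r hr hr' t (fun i => d i * z i)
  have h2 := h z
  have h3 : ∑ i, d i * t i * z i = ∑ i, t i * (d i * z i) :=
    Finset.sum_congr rfl fun i _ => by ring
  rw [h3] at hz
  have h4 : nrm r' t * nrm r (fun i => d i * z i) ≤ nrm r' t * (C * nrm p z) :=
    mul_le_mul_of_nonneg_left h2 (nrm_nonneg _ _)
  refine le_of_mul_le_mul_right ?_ hz0
  linarith

theorem signs_ge {H : Type*} [NormedAddCommGroup H] [InnerProductSpace ℝ H] {ι : Type*}
    (s : Finset ι) (y : ι → H) : ∃ e : ι → ℝ, (∀ i, |e i| = 1) ∧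
      ∑ i ∈ s, ‖y i‖ ^ 2 ≤ ‖∑ i ∈ s, e i • y i‖ ^ 2 := by
  classical
  induction s using Finset.induction_on with
  | empty => exact ⟨fun _ => 1, by simp, by simp⟩
  | insert a s ha ih =>
    obtain ⟨e, he, h⟩ := ih
    obtain ⟨c, hc, hc'⟩ : ∃ c : ℝ, |c| = 1 ∧ 0 ≤ c * inner ℝ (y a) (∑ i ∈ s, e i • y i) := by
      rcases le_total 0 (inner ℝ (y a) (∑ i ∈ s, e i • y i)) with h | h
      · exact ⟨1, by simp, by simpa⟩
      · exact ⟨-1, by simp, by simpa⟩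
    refine ⟨Function.update e a c, fun i => ?_, ?_⟩
    · by_cases hi : i = a
      · subst hi; simpa using hc
      · simpa [hi] using he i
    · rw [Finset.sum_insert ha, Finset.sum_insert ha]
      have : ∑ i ∈ s, Function.update e a c i • y i = ∑ i ∈ s, e i • y i :=
        Finset.sum_congr rfl fun i hi => by
          rw [Function.update_of_ne (show i ≠ a from fun h => ha (h ▸ hi))]
      rw [this, Function.update_self, norm_add_sq_real, norm_smul, real_inner_smul_left,
        Real.norm_eq_abs, hc]
      linarith

theorem signs_le {H : Type*} [NormedAddCommGroup H] [InnerProductSpace ℝ H] {ι : Type*}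
    (s : Finset ι) (y : ι → H) : ∃ e : ι → ℝ, (∀ i, |e i| = 1) ∧
      ‖∑ i ∈ s, e i • y i‖ ^ 2 ≤ ∑ i ∈ s, ‖y i‖ ^ 2 := by
  classical
  induction s using Finset.induction_on with
  | empty => exact ⟨fun _ => 1, by simp, by simp⟩
  | insert a s ha ih =>
    obtain ⟨e, he, h⟩ := ih
    obtain ⟨c, hc, hc'⟩ : ∃ c : ℝ, |c| = 1 ∧ c * inner ℝ (y a) (∑ i ∈ s, e i • y i) ≤ 0 := by
      rcases le_total 0 (inner ℝ (y a) (∑ i ∈ s, e i • y i)) with h | h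
      · exact ⟨-1, by simp, by simpa⟩
      · exact ⟨1, by simp, by simpa⟩
    refine ⟨Function.update e a c, fun i => ?_, ?_⟩
    · by_cases hi : i = a
      · subst hi; simpa using hc
      · simpa [hi] using he i
    · rw [Finset.sum_insert ha, Finset.sum_insert ha]
      have : ∑ i ∈ s, Function.update e a c i • y i = ∑ i ∈ s, e i • y i :=
        Finset.sum_congr rfl fun i hi => by
          rw [Function.update_of_ne (show i ≠ a from fun h => ha (h ▸ hi))]
      rw [this, Function.update_self, norm_add_sq_real, norm_smul, real_inner_smul_left,
        Real.norm_eq_abs, hc]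
      linarith

theorem dBM_bdd (E F : Type*) [NormedAddCommGroup E] [NormedSpace ℝ E]
    [NormedAddCommGroup F] [NormedSpace ℝ F] :
    BddBelow {c : ℝ | ∃ T : E ≃L[ℝ] F, c = ‖(T : E →L[ℝ] F)‖ * ‖(T.symm : F →L[ℝ] E)‖} :=
  ⟨0, by rintro c ⟨T, rfl⟩; positivity⟩

theorem dBM_le {E H : Type*} [NormedAddCommGroup E] [NormedSpace ℝ E]
    [FiniteDimensional ℝ E] [NormedAddCommGroup H] [InnerProductSpace ℝ H] (n : ℕ)
    (T : E ≃ₗ[ℝ] H) (hn : Module.finrank ℝ E = n) (A B : ℝ) (hA : 0 ≤ A) (hB : 0 ≤ B)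
    (h1 : ∀ x, ‖T x‖ ≤ A * ‖x‖) (h2 : ∀ x, ‖x‖ ≤ B * ‖T x‖) :
    dBM E (EuclideanSpace ℝ (Fin n)) ≤ A * B := by
  have : FiniteDimensional ℝ H := T.finiteDimensional
  have hnH : Module.finrank ℝ H = n := by rw [← T.finrank_eq, hn]
  let e : H ≃ₗᵢ[ℝ] EuclideanSpace ℝ (Fin n) :=
    ((stdOrthonormalBasis ℝ H).reindex (finCongr hnH)).repr
  let S : E ≃L[ℝ] EuclideanSpace ℝ (Fin n) :=
    T.toContinuousLinearEquiv.trans e.toContinuousLinearEquiv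
  have hS : ∀ x, ‖S x‖ = ‖T x‖ := fun x => e.norm_map (T x)
  refine (csInf_le (dBM_bdd _ _) ⟨S, rfl⟩).trans ?_
  refine mul_le_mul ?_ ?_ (norm_nonneg _) hA
  · refine ContinuousLinearMap.opNorm_le_bound _ hA fun x => ?_
    exact (hS x).trans_le (h1 x)
  · refine ContinuousLinearMap.opNorm_le_bound _ hB fun y => ?_
    have h3 := h2 (S.symm y)
    rw [← hS, S.apply_symm_apply] at h3
    exact h3

theorem dBM_nonempty (E : Type*) [NormedAddCommGroup E] [NormedSpace ℝ E]
    [FiniteDimensional ℝ E] (n : ℕ) (hn : Module.finrank ℝ E = n) :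
    {c : ℝ | ∃ T : E ≃L[ℝ] EuclideanSpace ℝ (Fin n), c = ‖(T : E →L[ℝ] EuclideanSpace ℝ (Fin n))‖ *
      ‖(T.symm : EuclideanSpace ℝ (Fin n) →L[ℝ] E)‖}.Nonempty :=
  ⟨_, ContinuousLinearEquiv.ofFinrankEq (by simp [hn]), rfl⟩

theorem one_le_dBM (E : Type*) [NormedAddCommGroup E] [NormedSpace ℝ E]
    [FiniteDimensional ℝ E] (n : ℕ) (hn : Module.finrank ℝ E = n) (h1 : 1 ≤ n) :
    1 ≤ dBM E (EuclideanSpace ℝ (Fin n)) := by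
  have : Nontrivial E := Module.nontrivial_of_finrank_pos (R := ℝ) (by omega)
  refine le_csInf (dBM_nonempty E n hn) ?_
  rintro c ⟨T, rfl⟩
  exact T.one_le_norm_mul_norm_symm

/-- Extremal vectors of an injective linear map into a Hilbert space. -/
theorem extremal {E H : Type*} [NormedAddCommGroup E] [NormedSpace ℝ E]
    [FiniteDimensional ℝ E] [NormedAddCommGroup H] [InnerProductSpace ℝ H] (n : ℕ)
    (S : E →ₗ[ℝ] H) (hS : Function.Injective S) (hn : Module.finrank ℝ E = n) (h1 : 1 ≤ n) :
    ∃ u v : E, ‖u‖ = 1 ∧ ‖v‖ = 1 ∧ 0 < ‖S v‖ ∧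
      dBM E (EuclideanSpace ℝ (Fin n)) * ‖S v‖ ≤ ‖S u‖ := by
  have : Nontrivial E := Module.nontrivial_of_finrank_pos (R := ℝ) (by omega)
  have hc : Continuous fun x => ‖S x‖ := (LinearMap.continuous_of_finiteDimensional S).norm
  have : ProperSpace E := FiniteDimensional.proper ℝ E
  have hcomp : IsCompact (Metric.sphere (0 : E) 1) := isCompact_sphere _ _
  have hne : (Metric.sphere (0 : E) 1).Nonempty := NormedSpace.sphere_nonempty.mpr zero_le_one
  obtain ⟨u, hu, hu'⟩ := hcomp.exists_isMaxOn hne hc.continuousOn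
  obtain ⟨v, hv, hv'⟩ := hcomp.exists_isMinOn hne hc.continuousOn
  have hu1 : ‖u‖ = 1 := by simpa using hu
  have hv1 : ‖v‖ = 1 := by simpa using hv
  have hv0 : 0 < ‖S v‖ := by
    rw [norm_pos_iff]
    intro h
    have : v = 0 := hS (by rw [h, map_zero])
    rw [this] at hv1
    simp at hv1
  have hunit : ∀ x : E, x ≠ 0 → ‖x‖⁻¹ • x ∈ Metric.sphere (0 : E) 1 := fun x hx => by
    simp [norm_smul, hx]
  have hscale : ∀ x : E, ‖S (‖x‖⁻¹ • x)‖ = ‖x‖⁻¹ * ‖S x‖ := fun x => by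
    rw [map_smul, norm_smul]; simp
  refine ⟨u, v, hu1, hv1, hv0, ?_⟩
  rw [← le_div_iff₀ hv0, div_eq_mul_inv]
  refine dBM_le n (LinearEquiv.ofInjective S hS) hn _ _ (norm_nonneg _)
    (inv_nonneg.mpr hv0.le) (fun x => ?_) fun x => ?_
  · change ‖S x‖ ≤ _
    by_cases hx : x = 0
    · simp [hx]
    have := hu' (hunit x hx)
    simp only [Set.mem_ofPred_eq] at this
    rw [hscale, inv_mul_le_iff₀ (norm_pos_iff.mpr hx)] at this
    linarith
  · change _ ≤ _ * ‖S x‖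
    by_cases hx : x = 0
    · simp [hx]
    have := hv' (hunit x hx)
    simp only [Set.mem_ofPred_eq] at this
    rw [hscale, le_inv_mul_iff₀ (norm_pos_iff.mpr hx)] at this
    rw [le_inv_mul_iff₀ hv0]
    linarith

theorem near_opt (E : Type*) [NormedAddCommGroup E] [NormedSpace ℝ E]
    [FiniteDimensional ℝ E] (n : ℕ) (hn : Module.finrank ℝ E = n) (h1 : 1 ≤ n) (c : ℝ)
    (hc : dBM E (EuclideanSpace ℝ (Fin n)) < c) :
    ∃ R : E ≃ₗ[ℝ] EuclideanSpace ℝ (Fin n), ∀ x, ‖x‖ ≤ ‖R x‖ ∧ ‖R x‖ ≤ c * ‖x‖ := by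
  have : Nontrivial E := Module.nontrivial_of_finrank_pos (R := ℝ) (by omega)
  obtain ⟨_, ⟨T, rfl⟩, hT⟩ := exists_lt_of_csInf_lt (dBM_nonempty E n hn) hc
  have hb : 0 < ‖(T.symm : EuclideanSpace ℝ (Fin n) →L[ℝ] E)‖ := T.norm_symm_pos
  refine ⟨T.toLinearEquiv.trans (LinearEquiv.smulOfNeZero ℝ _ _ hb.ne'), fun x => ?_⟩
  have hR : ‖(T.toLinearEquiv.trans (LinearEquiv.smulOfNeZero ℝ _ _ hb.ne')) x‖
      = ‖(T.symm : EuclideanSpace ℝ (Fin n) →L[ℝ] E)‖ * ‖T x‖ := by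
    change ‖‖(T.symm : EuclideanSpace ℝ (Fin n) →L[ℝ] E)‖ • T x‖ = _
    rw [norm_smul, norm_norm]
  rw [hR]
  constructor
  · have := (T.symm : EuclideanSpace ℝ (Fin n) →L[ℝ] E).le_opNorm (T x)
    simpa using this
  · have h3 := (T : E →L[ℝ] EuclideanSpace ℝ (Fin n)).le_opNorm x
    have h4 := mul_le_mul_of_nonneg_left h3 hb.le
    have h5 := mul_le_mul_of_nonneg_right hT.le (norm_nonneg x)
    refine h4.trans (le_trans (le_of_eq ?_) h5)
    ring

theorem near_opt' (E : Type*) [NormedAddCommGroup E] [NormedSpace ℝ E]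
    [FiniteDimensional ℝ E] (n : ℕ) (hn : Module.finrank ℝ E = n) (h1 : 1 ≤ n) (c : ℝ)
    (hc0 : 0 < c) (hc : dBM E (EuclideanSpace ℝ (Fin n)) < c) :
    ∃ R : E ≃ₗ[ℝ] EuclideanSpace ℝ (Fin n), ∀ x, ‖R x‖ ≤ ‖x‖ ∧ ‖x‖ ≤ c * ‖R x‖ := by
  obtain ⟨R, hR⟩ := near_opt E n hn h1 c hc
  refine ⟨R.trans (LinearEquiv.smulOfNeZero ℝ _ _ (inv_pos.mpr hc0).ne'), fun x => ?_⟩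
  have h : ‖(R.trans (LinearEquiv.smulOfNeZero ℝ _ _ (inv_pos.mpr hc0).ne')) x‖
      = c⁻¹ * ‖R x‖ := by
    change ‖c⁻¹ • R x‖ = _
    rw [norm_smul, Real.norm_eq_abs, abs_of_pos (inv_pos.mpr hc0)]
  rw [h]
  refine ⟨?_, ?_⟩
  · rw [inv_mul_le_iff₀ hc0]; exact (hR x).2
  · rw [mul_inv_cancel_left₀ hc0.ne']; exact (hR x).1

set_option linter.unusedSectionVars false

section
variable {k : ℕ} {n : Fin k → ℕ} {X : Fin k → Type} [∀ i, NormedAddCommGroup (X i)]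
  [∀ i, NormedSpace ℝ (X i)] [∀ i, FiniteDimensional ℝ (X i)]

theorem finrank_piLp (hdim : ∀ i, Module.finrank ℝ (X i) = n i) (p : ℝ≥0∞) [Fact (1 ≤ p)] :
    Module.finrank ℝ (PiLp p X) = ∑ i, n i := by
  rw [(WithLp.linearEquiv p ℝ (∀ i, X i)).finrank_eq, Module.finrank_pi_fintype]
  exact Finset.sum_congr rfl fun i _ => hdim i

/-- The block-diagonal linear equivalence. -/
noncomputable def blockMap (p : ℝ≥0∞) (R : ∀ i, X i ≃ₗ[ℝ] EuclideanSpace ℝ (Fin (n i))) :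
    PiLp p X ≃ₗ[ℝ] PiLp 2 (fun i => EuclideanSpace ℝ (Fin (n i))) :=
  (WithLp.linearEquiv p ℝ (∀ i, X i)).trans ((LinearEquiv.piCongrRight R).trans
    (WithLp.linearEquiv 2 ℝ (∀ i, EuclideanSpace ℝ (Fin (n i)))).symm)

theorem norm_blockMap (p : ℝ≥0∞) (R : ∀ i, X i ≃ₗ[ℝ] EuclideanSpace ℝ (Fin (n i)))
    (x : PiLp p X) : ‖blockMap p R x‖ = nrm 2 (fun i => ‖R i (x i)‖) :=
  norm_eq_nrm 2 (fun i => EuclideanSpace ℝ (Fin (n i))) _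

theorem upper_ge (hn : ∀ i, 1 ≤ n i) (hdim : ∀ i, Module.finrank ℝ (X i) = n i)
    (d : Fin k → ℝ) (hd : ∀ i, d i = dBM (X i) (EuclideanSpace ℝ (Fin (n i))))
    (p : ℝ≥0∞) [Fact (1 ≤ p)] (hp : 2 ≤ p) (C : ℝ) (hC : 0 ≤ C)
    (h : ∀ t : Fin k → ℝ, nrm 2 (fun i => d i * t i) ≤ C * nrm p t) :
    dBM (PiLp p X) (EuclideanSpace ℝ (Fin (∑ i, n i))) ≤ C := by
  have hd1 : ∀ i, 1 ≤ d i := fun i => hd i ▸ one_le_dBM (X i) (n i) (hdim i) (hn i)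
  have key : ∀ ε : ℝ, 1 < ε →
      dBM (PiLp p X) (EuclideanSpace ℝ (Fin (∑ i, n i))) ≤ ε * C := by
    intro ε hε
    have hlt : ∀ i, dBM (X i) (EuclideanSpace ℝ (Fin (n i))) < ε * d i := fun i => by
      rw [← hd i]; nlinarith [hd1 i]
    choose R hR using fun i => near_opt (X i) (n i) (hdim i) (hn i) _ (hlt i)
    have := dBM_le (∑ i, n i) (blockMap p R) (finrank_piLp hdim p) (ε * C) 1 (by positivity)
      zero_le_one (fun x => ?_) (fun x => ?_)
    · simpa using this
    · rw [norm_blockMap, norm_eq_nrm]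
      calc nrm 2 (fun i => ‖R i (x i)‖) ≤ nrm 2 (fun i => ε * (d i * ‖x i‖)) := by
            refine nrm_mono 2 fun i => ?_
            rw [abs_norm]
            refine ((hR i (x i)).2).trans (le_trans (le_of_eq ?_) (le_abs_self _))
            ring
        _ = ε * nrm 2 (fun i => d i * ‖x i‖) := nrm_smul 2 ε (by positivity) _
        _ ≤ ε * (C * nrm p (fun i => ‖x i‖)) := by gcongr; exact h _
        _ = _ := by ring
    · rw [norm_blockMap, norm_eq_nrm, one_mul]
      refine (nrm_anti 2 p hp _).trans (nrm_mono 2 fun i => ?_)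
      rw [abs_norm, abs_norm]
      exact (hR i (x i)).1
  refine le_of_forall_pos_le_add fun δ hδ => ?_
  have h2 := key (1 + δ / (C + 1)) (by have : 0 < δ / (C + 1) := by positivity
                                       linarith)
  have h3 : δ / (C + 1) * C ≤ δ := by
    rw [div_mul_eq_mul_div, div_le_iff₀ (by positivity)]; nlinarith
  linarith

theorem upper_le (hn : ∀ i, 1 ≤ n i) (hdim : ∀ i, Module.finrank ℝ (X i) = n i)
    (d : Fin k → ℝ) (hd : ∀ i, d i = dBM (X i) (EuclideanSpace ℝ (Fin (n i))))
    (p : ℝ≥0∞) [Fact (1 ≤ p)] (hp : p ≤ 2) (C : ℝ) (hC : 0 ≤ C)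
    (h : ∀ t : Fin k → ℝ, nrm p (fun i => d i * t i) ≤ C * nrm 2 t) :
    dBM (PiLp p X) (EuclideanSpace ℝ (Fin (∑ i, n i))) ≤ C := by
  have hd1 : ∀ i, 1 ≤ d i := fun i => hd i ▸ one_le_dBM (X i) (n i) (hdim i) (hn i)
  have key : ∀ ε : ℝ, 1 < ε →
      dBM (PiLp p X) (EuclideanSpace ℝ (Fin (∑ i, n i))) ≤ ε * C := by
    intro ε hε
    have hlt : ∀ i, dBM (X i) (EuclideanSpace ℝ (Fin (n i))) < ε * d i := fun i => by
      rw [← hd i]; nlinarith [hd1 i]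
    choose R hR using fun i => near_opt' (X i) (n i) (hdim i) (hn i) _
      (by nlinarith [hd1 i]) (hlt i)
    have := dBM_le (∑ i, n i) (blockMap p R) (finrank_piLp hdim p) 1 (ε * C) zero_le_one
      (by positivity) (fun x => ?_) (fun x => ?_)
    · simpa using this
    · rw [norm_blockMap, norm_eq_nrm, one_mul]
      refine le_trans (nrm_mono 2 fun i => ?_) (nrm_anti p 2 hp _)
      rw [abs_norm, abs_norm]
      exact (hR i (x i)).1
    · rw [norm_blockMap, norm_eq_nrm]
      calc nrm p (fun i => ‖x i‖) ≤ nrm p (fun i => ε * (d i * ‖R i (x i)‖)) := by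
            refine nrm_mono p fun i => ?_
            rw [abs_norm]
            refine ((hR i (x i)).2).trans (le_trans (le_of_eq ?_) (le_abs_self _))
            ring
        _ = ε * nrm p (fun i => d i * ‖R i (x i)‖) := nrm_smul p ε (by positivity) _
        _ ≤ ε * (C * nrm 2 (fun i => ‖R i (x i)‖)) := by gcongr; exact h _
        _ = _ := by ring
  refine le_of_forall_pos_le_add fun δ hδ => ?_
  have h2 := key (1 + δ / (C + 1)) (by have : 0 < δ / (C + 1) := by positivity
                                       linarith)
  have h3 : δ / (C + 1) * C ≤ δ := by
    rw [div_mul_eq_mul_div, div_le_iff₀ (by positivity)]; nlinarith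
  linarith

/-- Restriction of a map on the direct sum to one summand. -/
noncomputable def restr {H : Type*} [NormedAddCommGroup H] [NormedSpace ℝ H] (p : ℝ≥0∞)
    [Fact (1 ≤ p)] (T : PiLp p X ≃L[ℝ] H) (i : Fin k) : X i →ₗ[ℝ] H :=
  T.toLinearEquiv.toLinearMap ∘ₗ (WithLp.linearEquiv p ℝ (∀ i, X i)).symm.toLinearMap ∘ₗ
    LinearMap.single ℝ X i

theorem restr_apply {H : Type*} [NormedAddCommGroup H] [NormedSpace ℝ H] (p : ℝ≥0∞)
    [Fact (1 ≤ p)] (T : PiLp p X ≃L[ℝ] H) (i : Fin k) (x : X i) :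
    restr p T i x = T (PiLp.single p i x) := rfl

theorem sum_restr {H : Type*} [NormedAddCommGroup H] [NormedSpace ℝ H] (p : ℝ≥0∞)
    [Fact (1 ≤ p)] (T : PiLp p X ≃L[ℝ] H) (x : ∀ i, X i) :
    ∑ i, restr p T i (x i) = T (WithLp.toLp p x) := by
  simp only [restr_apply]
  rw [← map_sum]
  congr 1
  ext j
  simp [Finset.sum_apply]

theorem restr_inj {H : Type*} [NormedAddCommGroup H] [NormedSpace ℝ H] (p : ℝ≥0∞)
    [Fact (1 ≤ p)] (T : PiLp p X ≃L[ℝ] H) (i : Fin k) : Function.Injective (restr p T i) := by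
  intro x y h
  exact Pi.single_injective i (WithLp.toLp_injective p (T.injective h))

theorem le_of_symm {E H : Type*} [NormedAddCommGroup E] [NormedSpace ℝ E]
    [NormedAddCommGroup H] [NormedSpace ℝ H] (T : E ≃L[ℝ] H) (x : E) :
    ‖x‖ ≤ ‖(T.symm : H →L[ℝ] E)‖ * ‖T x‖ := by
  have := (T.symm : H →L[ℝ] E).le_opNorm (T x)
  simpa using this

theorem lower_ge (hn : ∀ i, 1 ≤ n i) (hdim : ∀ i, Module.finrank ℝ (X i) = n i)
    (d : Fin k → ℝ) (hd : ∀ i, d i = dBM (X i) (EuclideanSpace ℝ (Fin (n i))))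
    (p : ℝ≥0∞) [Fact (1 ≤ p)] {H : Type*} [NormedAddCommGroup H] [InnerProductSpace ℝ H]
    (T : PiLp p X ≃L[ℝ] H) (t : Fin k → ℝ) :
    nrm 2 (fun i => d i * t i) ≤
      ‖(T : PiLp p X →L[ℝ] H)‖ * ‖(T.symm : H →L[ℝ] PiLp p X)‖ * nrm p t := by
  have hd1 : ∀ i, 1 ≤ d i := fun i => hd i ▸ one_le_dBM (X i) (n i) (hdim i) (hn i)
  set A := ‖(T : PiLp p X →L[ℝ] H)‖ with hA
  set B := ‖(T.symm : H →L[ℝ] PiLp p X)‖ with hB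
  have hA0 : 0 ≤ A := norm_nonneg _
  have hB0 : 0 ≤ B := norm_nonneg _
  choose u v hu hv hv0 huv using
    fun i => extremal (n i) (restr p T i) (restr_inj p T i) (hdim i) (hn i)
  have hdu : ∀ i, d i ≤ B * ‖restr p T i (u i)‖ := by
    intro i
    have h1 := le_of_symm T (PiLp.single p i (v i))
    rw [PiLp.norm_single, hv, ← restr_apply, ← hB] at h1
    have h2 := huv i
    rw [← hd] at h2
    have h3 := mul_le_mul_of_nonneg_left h2 hB0
    nlinarith [hd1 i]
  obtain ⟨e, he, hs⟩ := signs_ge Finset.univ (fun i => restr p T i (t i • u i))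
  have h1 : nrm 2 (fun i => ‖restr p T i (u i)‖ * t i) ≤ A * nrm p t := by
    refine le_of_sq_le_sq ?_ (mul_nonneg hA0 (nrm_nonneg _ _))
    rw [nrm_two_sq]
    calc ∑ i, (‖restr p T i (u i)‖ * t i) ^ 2 = ∑ i, ‖restr p T i (t i • u i)‖ ^ 2 := by
          refine Finset.sum_congr rfl fun i _ => ?_
          rw [map_smul, norm_smul, mul_pow, mul_pow, Real.norm_eq_abs, sq_abs]
          ring
      _ ≤ _ := hs
      _ = ‖T (WithLp.toLp p fun i => e i • t i • u i)‖ ^ 2 := by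
          rw [← sum_restr]; simp only [map_smul]
      _ ≤ (A * nrm p t) ^ 2 := by
          refine pow_le_pow_left₀ (norm_nonneg _) ?_ 2
          refine ((T : PiLp p X →L[ℝ] H).le_opNorm _).trans ?_
          rw [← hA, norm_eq_nrm]
          refine mul_le_mul_of_nonneg_left (nrm_mono p fun i => ?_) hA0
          simp [norm_smul, he, hu]
  calc nrm 2 (fun i => d i * t i) ≤ nrm 2 (fun i => B * (‖restr p T i (u i)‖ * t i)) := by
        refine nrm_mono 2 fun i => ?_
        rw [← mul_assoc, abs_mul, abs_mul]
        refine mul_le_mul_of_nonneg_right ?_ (abs_nonneg _)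
        exact abs_le_abs_of_nonneg (by linarith [hd1 i]) (hdu i)
    _ = B * nrm 2 (fun i => ‖restr p T i (u i)‖ * t i) := nrm_smul 2 B hB0 _
    _ ≤ B * (A * nrm p t) := mul_le_mul_of_nonneg_left h1 hB0
    _ = _ := by ring

theorem lower_le (hn : ∀ i, 1 ≤ n i) (hdim : ∀ i, Module.finrank ℝ (X i) = n i)
    (d : Fin k → ℝ) (hd : ∀ i, d i = dBM (X i) (EuclideanSpace ℝ (Fin (n i))))
    (p : ℝ≥0∞) [Fact (1 ≤ p)] {H : Type*} [NormedAddCommGroup H] [InnerProductSpace ℝ H]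
    (T : PiLp p X ≃L[ℝ] H) (t : Fin k → ℝ) :
    nrm p (fun i => d i * t i) ≤
      ‖(T : PiLp p X →L[ℝ] H)‖ * ‖(T.symm : H →L[ℝ] PiLp p X)‖ * nrm 2 t := by
  have hd1 : ∀ i, 1 ≤ d i := fun i => hd i ▸ one_le_dBM (X i) (n i) (hdim i) (hn i)
  set A := ‖(T : PiLp p X →L[ℝ] H)‖ with hA
  set B := ‖(T.symm : H →L[ℝ] PiLp p X)‖ with hB
  have hA0 : 0 ≤ A := norm_nonneg _
  have hB0 : 0 ≤ B := norm_nonneg _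
  choose u v hu hv hv0 huv using
    fun i => extremal (n i) (restr p T i) (restr_inj p T i) (hdim i) (hn i)
  have hdv : ∀ i, d i ≤ A * ‖restr p T i (v i)‖⁻¹ := by
    intro i
    have h1 := (T : PiLp p X →L[ℝ] H).le_opNorm (PiLp.single p i (u i))
    rw [PiLp.norm_single, hu, mul_one, ← hA] at h1
    have h2 := huv i
    rw [← hd] at h2
    rw [← div_eq_mul_inv, le_div_iff₀ (hv0 i)]
    exact h2.trans h1
  obtain ⟨e, he, hs⟩ := signs_le Finset.univ
    (fun i => restr p T i ((‖restr p T i (v i)‖⁻¹ * t i) • v i))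
  have h1 : nrm p (fun i => ‖restr p T i (v i)‖⁻¹ * t i) ≤ B * nrm 2 t := by
    have h2 : ‖T (WithLp.toLp p fun i => e i • (‖restr p T i (v i)‖⁻¹ * t i) • v i)‖
        ≤ nrm 2 t := by
      refine le_of_sq_le_sq ?_ (nrm_nonneg _ _)
      rw [← sum_restr]
      simp only [map_smul] at hs ⊢
      refine hs.trans (le_of_eq ?_)
      rw [nrm_two_sq]
      refine Finset.sum_congr rfl fun i _ => ?_
      rw [norm_smul, norm_mul, norm_inv, norm_norm, mul_right_comm,
        inv_mul_cancel₀ (hv0 i).ne', one_mul, Real.norm_eq_abs, sq_abs]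
    have h3 := le_of_symm T (WithLp.toLp p fun i => e i • (‖restr p T i (v i)‖⁻¹ * t i) • v i)
    rw [← hB, norm_eq_nrm] at h3
    refine le_trans (nrm_mono p fun i => ?_) (h3.trans (mul_le_mul_of_nonneg_left h2 hB0))
    simp [norm_smul, he, hv]
  calc nrm p (fun i => d i * t i) ≤ nrm p (fun i => A * (‖restr p T i (v i)‖⁻¹ * t i)) := by
        refine nrm_mono p fun i => ?_
        rw [← mul_assoc, abs_mul, abs_mul]
        refine mul_le_mul_of_nonneg_right ?_ (abs_nonneg _)
        exact abs_le_abs_of_nonneg (by linarith [hd1 i]) (hdv i)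
    _ = A * nrm p (fun i => ‖restr p T i (v i)‖⁻¹ * t i) := nrm_smul p A hA0 _
    _ ≤ A * (B * nrm 2 t) := mul_le_mul_of_nonneg_left h1 hA0
    _ = _ := by ring

theorem dBM_nonneg (E F : Type*) [NormedAddCommGroup E] [NormedSpace ℝ E]
    [NormedAddCommGroup F] [NormedSpace ℝ F] : 0 ≤ dBM E F :=
  Real.sInf_nonneg (by rintro c ⟨T, rfl⟩; positivity)

theorem dBM_le_iff_ge (hn : ∀ i, 1 ≤ n i) (hdim : ∀ i, Module.finrank ℝ (X i) = n i)
    (d : Fin k → ℝ) (hd : ∀ i, d i = dBM (X i) (EuclideanSpace ℝ (Fin (n i))))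
    (p : ℝ≥0∞) [Fact (1 ≤ p)] (hp : 2 ≤ p) (C : ℝ) (hC : 0 ≤ C) :
    dBM (PiLp p X) (EuclideanSpace ℝ (Fin (∑ i, n i))) ≤ C ↔
    ∀ t : Fin k → ℝ, nrm 2 (fun i => d i * t i) ≤ C * nrm p t := by
  refine ⟨fun h t => ?_, upper_ge hn hdim d hd p hp C hC⟩
  refine le_trans ?_ (mul_le_mul_of_nonneg_right h (nrm_nonneg _ _))
  rcases (nrm_nonneg p t).eq_or_lt with h0 | h0
  · rw [← h0, nrm_eq_zero p h0.symm]
    simp only [Pi.zero_apply, mul_zero]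
    exact (nrm_zero (k := k) 2).le
  · rw [← div_le_iff₀ h0]
    refine le_csInf (dBM_nonempty _ _ (finrank_piLp hdim p)) ?_
    rintro c ⟨T, rfl⟩
    rw [div_le_iff₀ h0]
    exact lower_ge hn hdim d hd p T t

theorem dBM_le_iff_le (hn : ∀ i, 1 ≤ n i) (hdim : ∀ i, Module.finrank ℝ (X i) = n i)
    (d : Fin k → ℝ) (hd : ∀ i, d i = dBM (X i) (EuclideanSpace ℝ (Fin (n i))))
    (p : ℝ≥0∞) [Fact (1 ≤ p)] (hp : p ≤ 2) (C : ℝ) (hC : 0 ≤ C) :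
    dBM (PiLp p X) (EuclideanSpace ℝ (Fin (∑ i, n i))) ≤ C ↔
    ∀ t : Fin k → ℝ, nrm p (fun i => d i * t i) ≤ C * nrm 2 t := by
  refine ⟨fun h t => ?_, upper_le hn hdim d hd p hp C hC⟩
  refine le_trans ?_ (mul_le_mul_of_nonneg_right h (nrm_nonneg _ _))
  rcases (nrm_nonneg 2 t).eq_or_lt with h0 | h0
  · rw [← h0, nrm_eq_zero 2 h0.symm]
    simp only [Pi.zero_apply, mul_zero]
    exact (nrm_zero (k := k) p).le
  · rw [← div_le_iff₀ h0]
    refine le_csInf (dBM_nonempty _ _ (finrank_piLp hdim p)) ?_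
    rintro c ⟨T, rfl⟩
    rw [div_le_iff₀ h0]
    exact lower_le hn hdim d hd p T t

theorem conj_eq (hn : ∀ i, 1 ≤ n i) (hdim : ∀ i, Module.finrank ℝ (X i) = n i)
    (d : Fin k → ℝ) (hd : ∀ i, d i = dBM (X i) (EuclideanSpace ℝ (Fin (n i))))
    (p q : ℝ≥0∞) [Fact (1 ≤ p)] [Fact (1 ≤ q)] (hp : 2 ≤ p) (hq : q ≤ 2)
    (hpq : 1 / p + 1 / q = 1) :
    dBM (PiLp p X) (EuclideanSpace ℝ (Fin (∑ i, n i))) =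
    dBM (PiLp q X) (EuclideanSpace ℝ (Fin (∑ i, n i))) := by
  have hq' : q ≠ ∞ := ne_top_of_le_ne_top (by simp) hq
  have h22 : (1 : ℝ≥0∞) / 2 + 1 / 2 = 1 := by simp [ENNReal.inv_two_add_inv_two]
  have key : ∀ C : ℝ, 0 ≤ C → (dBM (PiLp p X) (EuclideanSpace ℝ (Fin (∑ i, n i))) ≤ C ↔
      dBM (PiLp q X) (EuclideanSpace ℝ (Fin (∑ i, n i))) ≤ C) := by
    intro C hC
    rw [dBM_le_iff_ge hn hdim d hd p hp C hC, dBM_le_iff_le hn hdim d hd q hq C hC]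
    exact ⟨fun h => dual_nrm p q 2 2 hpq hq' h22 (by simp) d C hC h,
      fun h => dual_nrm 2 2 q p h22 (by simp) hpq hq' d C hC h⟩
  exact le_antisymm ((key _ (dBM_nonneg _ _)).mpr le_rfl) ((key _ (dBM_nonneg _ _)).mp le_rfl)

end

open Module in
/-- monotonicity and extreme values of
`f p = d_BM(X₁ ⊕_p ⋯ ⊕_p X_k, ℓ₂^N)` in `p ∈ [1,∞]`. -/
theorem stmt_13 (k : ℕ) (hk : 1 ≤ k) (n : Fin k → ℕ) (hn : ∀ i, 1 ≤ n i)
    (X : Fin k → Type) [∀ i, NormedAddCommGroup (X i)] [∀ i, NormedSpace ℝ (X i)]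
    [∀ i, FiniteDimensional ℝ (X i)] (hdim : ∀ i, Module.finrank ℝ (X i) = n i)
    (d : Fin k → ℝ) (hd : ∀ i, d i = dBM (X i) (EuclideanSpace ℝ (Fin (n i))))
    (f : ℝ≥0∞ → ℝ)
    (hf : ∀ (p : ℝ≥0∞) [Fact (1 ≤ p)],
      f p = dBM (PiLp p X) (EuclideanSpace ℝ (Fin (∑ i, n i)))) :
    haveI : Nonempty (Fin k) := Fin.pos_iff_nonempty.mp hk
    (f 2 = ⨆ i, d i) ∧
    (∀ p : ℝ≥0∞, 1 ≤ p → f 2 ≤ f p ∧ f p ≤ f 1) ∧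
    (∀ p q : ℝ≥0∞, 1 ≤ p → 1 / p + 1 / q = 1 → f p = f q) ∧
    f 1 = f ∞ ∧ f ∞ = Real.sqrt (∑ i, d i ^ 2) := by
  have hC0 : ∀ (p : ℝ≥0∞), 1 ≤ p → 0 ≤ f p := fun p hp => by
    have : Fact (1 ≤ p) := ⟨hp⟩
    rw [hf p]; exact dBM_nonneg _ _
  have hge : ∀ (p : ℝ≥0∞) [Fact (1 ≤ p)], 2 ≤ p → ∀ C : ℝ, 0 ≤ C →
      (f p ≤ C ↔ ∀ t : Fin k → ℝ, nrm 2 (fun i => d i * t i) ≤ C * nrm p t) := by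
    intro p _ hp C hC
    rw [hf p]
    exact dBM_le_iff_ge hn hdim d hd p hp C hC
  have hd1 : ∀ i, 1 ≤ d i := fun i => hd i ▸ one_le_dBM (X i) (n i) (hdim i) (hn i)
  have h12 : (1 : ℝ≥0∞) ≤ 2 := by norm_num
  have hhalf : (2 : ℝ≥0∞)⁻¹ + 2⁻¹ = 1 := ENNReal.inv_two_add_inv_two
  have hne : (2 : ℝ≥0∞)⁻¹ ≠ ∞ := by simp
  have hq2 : ∀ p q : ℝ≥0∞, 1 / p + 1 / q = 1 → 2 ≤ p → q ≤ 2 := by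
    intro p q hpq hp
    rw [one_div, one_div] at hpq
    have h1 : p⁻¹ ≤ 2⁻¹ := ENNReal.inv_le_inv.mpr hp
    rw [← ENNReal.inv_le_inv]
    by_contra! h
    have := ENNReal.add_lt_add_of_le_of_lt (ne_top_of_le_ne_top hne h1) h1 h
    rw [hpq, hhalf] at this
    exact lt_irrefl _ this
  have hq2' : ∀ p q : ℝ≥0∞, 1 / p + 1 / q = 1 → p ≤ 2 → 2 ≤ q := by
    intro p q hpq hp
    rw [one_div, one_div] at hpq
    have h1 : 2⁻¹ ≤ p⁻¹ := ENNReal.inv_le_inv.mpr hp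
    rw [← ENNReal.inv_le_inv]
    by_contra! h
    have := ENNReal.add_lt_add_of_le_of_lt hne h1 h
    rw [hpq, hhalf] at this
    exact lt_irrefl _ this
  have hq1 : ∀ p q : ℝ≥0∞, 1 / p + 1 / q = 1 → 1 ≤ q := by
    intro p q hpq
    rw [one_div, one_div] at hpq
    rw [← ENNReal.inv_le_inv, inv_one, ← hpq]
    exact le_add_self
  have hconj : ∀ p q : ℝ≥0∞, 1 ≤ p → 1 / p + 1 / q = 1 → f p = f q := by
    intro p q hp hpq
    have : Fact (1 ≤ p) := ⟨hp⟩
    have : Fact (1 ≤ q) := ⟨hq1 p q hpq⟩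
    rw [hf p, hf q]
    rcases le_total 2 p with h | h
    · exact conj_eq hn hdim d hd p q h (hq2 p q hpq h) hpq
    · exact (conj_eq hn hdim d hd q p (hq2' p q hpq h) h (by rw [add_comm]; exact hpq)).symm
  have h1top : f 1 = f ∞ := hconj 1 ∞ le_rfl (by simp)
  have hmono : ∀ p : ℝ≥0∞, 2 ≤ p → f 2 ≤ f p ∧ f p ≤ f 1 := by
    intro p hp
    have hp1 : 1 ≤ p := h12.trans hp
    have : Fact (1 ≤ p) := ⟨hp1⟩
    rw [h1top]
    constructor
    · rw [hge 2 le_rfl _ (hC0 p hp1)]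
      intro t
      exact ((hge p hp _ (hC0 p hp1)).mp le_rfl t).trans
        (mul_le_mul_of_nonneg_left (nrm_anti 2 p hp t) (hC0 p hp1))
    · rw [hge p hp _ (hC0 ∞ le_top)]
      intro t
      exact ((hge ∞ le_top _ (hC0 ∞ le_top)).mp le_rfl t).trans
        (mul_le_mul_of_nonneg_left (nrm_anti p ∞ le_top t) (hC0 ∞ le_top))
  have hnon : Nonempty (Fin k) := Fin.pos_iff_nonempty.mp hk
  have hbdd : BddAbove (Set.range d) := (Set.finite_range d).bddAbove
  have hsup0 : 0 ≤ ⨆ i, d i := Real.iSup_nonneg fun i => zero_le_one.trans (hd1 i)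
  have hnd : nrm 2 d = Real.sqrt (∑ i, d i ^ 2) := by
    rw [← nrm_two_sq, Real.sqrt_sq (nrm_nonneg _ _)]
  refine ⟨le_antisymm ?_ ?_, ?_, hconj, h1top, ?_⟩
  · rw [hge 2 le_rfl _ hsup0]
    intro t
    rw [← nrm_smul 2 _ hsup0]
    refine nrm_mono 2 fun i => ?_
    rw [abs_mul, abs_mul]
    refine mul_le_mul_of_nonneg_right ?_ (abs_nonneg _)
    exact abs_le_abs_of_nonneg (zero_le_one.trans (hd1 i)) (le_ciSup hbdd i)
  · refine ciSup_le fun i => ?_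
    have h := (hge 2 le_rfl _ (hC0 2 h12)).mp le_rfl (Pi.single i 1)
    rw [nrm_single, abs_one, mul_one] at h
    have h2 := abs_le_nrm 2 (fun j => d j * (Pi.single i 1 : Fin k → ℝ) j) i
    simp only [Pi.single_eq_same, mul_one] at h2
    exact (le_abs_self _).trans (h2.trans h)
  · intro p hp
    rcases le_total 2 p with h | h
    · exact hmono p h
    · have hpq : 1 / p + 1 / (1 - p⁻¹)⁻¹ = 1 := by
        rw [one_div, one_div, inv_inv]
        exact add_tsub_cancel_of_le (ENNReal.inv_le_one.mpr hp)
      rw [hconj p _ hp hpq]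
      exact hmono _ (hq2' p _ hpq h)
  · rw [← hnd]
    refine le_antisymm ?_ ?_
    · rw [hge ∞ le_top _ (nrm_nonneg _ _)]
      intro t
      rw [mul_comm, ← nrm_smul 2 _ (nrm_nonneg _ _)]
      refine nrm_mono 2 fun i => ?_
      rw [abs_mul, abs_mul, mul_comm, abs_of_nonneg (nrm_nonneg ∞ t)]
      exact mul_le_mul_of_nonneg_right (abs_le_nrm ∞ t i) (abs_nonneg _)
    · have h := (hge ∞ le_top _ (hC0 ∞ le_top)).mp le_rfl (fun _ => 1)
      have h2 : nrm ∞ (fun _ : Fin k => (1 : ℝ)) = 1 := by rw [nrm_top]; simp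
      rw [h2, mul_one] at h
      simpa only [mul_one] using h
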